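/- Let n ≥ 2. If 𝔤 is a Lie subalgebra of sl_{2n}(ℝ) containing sp(2n,ℝ), then 𝔤 = sp(2n,ℝ) or 𝔤 = sl_{2n}(ℝ). In particular, sp(2n,ℝ) is a maximal proper Lie subalgebra of sl_{2n}(ℝ). -/

import Mathlib

open Matrix

noncomputable section

abbrev Mat (n : ℕ) := Matrix (Fin (2*n)) (Fin (2*n)) ℝ

/-- The standard symplectic matrix `J_n` with block form `(0 Iₙ; -Iₙ 0)`. -/
def Jmat (n : ℕ) : Mat n :=
  fun i j => if (i : ℕ) + n = (j : ℕ) then 1 else if (j : ℕ) + n = (i : ℕ) then -1 else 0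

/-- The symplectic Lie algebra `sp(2n,ℝ) = {X ∈ sl_{2n}(ℝ) : Xᵀ Jₙ + Jₙ X = 0}`. -/
def spSet (n : ℕ) : Set (Mat n) := {X | X.trace = 0 ∧ Xᵀ * Jmat n + Jmat n * X = 0}

section aux

variable {ι : Type*} [Fintype ι] [DecidableEq ι]

lemma aux_dot (p q : ι → ℝ) (h : ∀ c : ℝ, q ≠ c • p) : ∃ v : ι → ℝ, v ⬝ᵥ p = 0 ∧ v ⬝ᵥ q ≠ 0 := by
  have h1 : (q - ((q ⬝ᵥ p) / (p ⬝ᵥ p)) • p) ⬝ᵥ p = 0 := by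
    by_cases hp : p ⬝ᵥ p = 0
    · have : p = 0 := dotProduct_self_eq_zero.mp hp
      simp [this]
    · simp only [sub_dotProduct, smul_dotProduct, smul_eq_mul]
      field_simp
      ring
  refine ⟨q - ((q ⬝ᵥ p) / (p ⬝ᵥ p)) • p, h1, fun h2 => ?_⟩
  have h3 : (q - ((q ⬝ᵥ p) / (p ⬝ᵥ p)) • p) ⬝ᵥ (q - ((q ⬝ᵥ p) / (p ⬝ᵥ p)) • p) = 0 := by
    rw [dotProduct_sub, h2, dotProduct_smul, h1]; simp
  exact h _ (sub_eq_zero.mp (dotProduct_self_eq_zero.mp h3))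

def auxR (J : Matrix ι ι ℝ) (x y : ι → ℝ) : Matrix ι ι ℝ := vecMulVec x (y ᵥ* J)

def auxw (J : Matrix ι ι ℝ) (x y : ι → ℝ) : ℝ := (x ᵥ* J) ⬝ᵥ y

lemma auxw_add_left (J : Matrix ι ι ℝ) (x y z : ι → ℝ) :
    auxw J (x + y) z = auxw J x z + auxw J y z := by
  simp [auxw, add_vecMul, add_dotProduct]

lemma auxw_add_right (J : Matrix ι ι ℝ) (x y z : ι → ℝ) :
    auxw J x (y + z) = auxw J x y + auxw J x z := by
  simp [auxw, dotProduct_add]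

lemma auxw_smul_left (J : Matrix ι ι ℝ) (c : ℝ) (x y : ι → ℝ) :
    auxw J (c • x) y = c * auxw J x y := by
  simp [auxw, smul_vecMul, smul_dotProduct]

lemma auxw_smul_right (J : Matrix ι ι ℝ) (c : ℝ) (x y : ι → ℝ) :
    auxw J x (c • y) = c * auxw J x y := by
  simp [auxw, dotProduct_smul]

lemma auxw_swap (J : Matrix ι ι ℝ) (hJ : Jᵀ = -J) (x y : ι → ℝ) :
    auxw J x y = - auxw J y x := by
  unfold auxw
  rw [← dotProduct_mulVec, ← vecMul_transpose, hJ, vecMul_neg, dotProduct_neg, dotProduct_comm]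

lemma auxw_self (J : Matrix ι ι ℝ) (hJ : Jᵀ = -J) (x : ι → ℝ) : auxw J x x = 0 := by
  have := auxw_swap J hJ x x
  linarith

lemma auxR_add_left (J : Matrix ι ι ℝ) (x y z : ι → ℝ) :
    auxR J (x + y) z = auxR J x z + auxR J y z := by
  simp [auxR, add_vecMulVec]

lemma auxR_add_right (J : Matrix ι ι ℝ) (x y z : ι → ℝ) :
    auxR J x (y + z) = auxR J x y + auxR J x z := by
  simp [auxR, vecMulVec_add, add_vecMul]

lemma auxR_smul_left (J : Matrix ι ι ℝ) (c : ℝ) (x y : ι → ℝ) :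
    auxR J (c • x) y = c • auxR J x y := by
  simp [auxR, smul_vecMulVec]

lemma auxR_smul_right (J : Matrix ι ι ℝ) (c : ℝ) (x y : ι → ℝ) :
    auxR J x (c • y) = c • auxR J x y := by
  simp [auxR, vecMulVec_smul, smul_vecMul]

lemma auxR_mul (J : Matrix ι ι ℝ) (x y z t : ι → ℝ) :
    auxR J x y * auxR J z t = auxw J y z • auxR J x t := by
  simp [auxR, auxw, vecMulVec_mul_vecMulVec, vecMulVec_smul]

lemma aux_mulR (J A : Matrix ι ι ℝ) (x y : ι → ℝ) :
    A * auxR J x y = auxR J (A *ᵥ x) y := by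
  simp [auxR, mul_vecMulVec]

lemma auxR_mulA (J A : Matrix ι ι ℝ) (hA : J * A = Aᵀ * J) (x y : ι → ℝ) :
    auxR J x y * A = auxR J x (A *ᵥ y) := by
  simp only [auxR, vecMulVec_mul, vecMul_vecMul, hA]
  rw [← vecMul_vecMul, vecMul_transpose]

lemma auxw_A (J A : Matrix ι ι ℝ) (hJ : Jᵀ = -J) (hA : J * A = Aᵀ * J) (x : ι → ℝ) :
    auxw J x (A *ᵥ x) = 0 := by
  have h : auxw J x (A *ᵥ x) = auxw J (A *ᵥ x) x := by
    unfold auxw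
    rw [dotProduct_mulVec, vecMul_vecMul, hA, ← vecMul_vecMul, vecMul_transpose]
  have := auxw_swap J hJ x (A *ᵥ x)
  linarith

lemma auxT_sp (J : Matrix ι ι ℝ) (hJ : Jᵀ = -J) (x y : ι → ℝ) :
    (auxR J x y + auxR J y x).trace = 0 ∧
      (auxR J x y + auxR J y x)ᵀ * J + J * (auxR J x y + auxR J y x) = 0 := by
  constructor
  · have := auxw_swap J hJ x y
    simp only [auxR, auxw, trace_add, trace_vecMulVec] at *
    rw [dotProduct_comm x, dotProduct_comm y]
    linarith
  · have h : ∀ z : ι → ℝ, J *ᵥ z = - (z ᵥ* J) := fun z => by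
      rw [← vecMul_transpose, hJ, vecMul_neg]
    simp only [auxR, transpose_add, transpose_vecMulVec, add_mul, mul_add, vecMulVec_mul,
      mul_vecMulVec, h, neg_vecMulVec]
    abel

/-- nondegeneracy -/
lemma auxw_exists (J : Matrix ι ι ℝ) (hJ : Jᵀ = -J) (hJJ : J * J = -1) (u w : ι → ℝ)
    (h : ∀ c : ℝ, w ≠ c • u) : ∃ v, auxw J v u = 0 ∧ auxw J v w ≠ 0 := by
  have hh : ∀ c : ℝ, J *ᵥ w ≠ c • (J *ᵥ u) := by
    intro c hc
    apply h c
    have := congrArg (fun z => J *ᵥ z) hc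
    simp only [mulVec_smul, mulVec_mulVec, hJJ, neg_mulVec, one_mulVec, smul_neg] at this
    exact neg_injective this
  obtain ⟨v, h1, h2⟩ := aux_dot _ _ hh
  exact ⟨v, by rwa [auxw, ← dotProduct_mulVec], by rwa [auxw, ← dotProduct_mulVec]⟩

lemma aux_scalar (A : Matrix ι ι ℝ) (h : ∀ u : ι → ℝ, ∃ c : ℝ, A *ᵥ u = c • u)
    (ht : A.trace = 0) : A = 0 := by
  have hd : ∀ i j, i ≠ j → A i j = 0 := by
    intro i j hij
    obtain ⟨c, hc⟩ := h (Pi.single j 1)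
    have := congrFun hc i
    simpa [hij] using this
  have he : ∀ i j, A i i = A j j := by
    intro i j
    by_cases hij : i = j
    · rw [hij]
    obtain ⟨c, hc⟩ := h (Pi.single i 1 + Pi.single j 1)
    have h1 := congrFun hc i
    have h2 := congrFun hc j
    simp [mulVec_add, hij, Ne.symm hij, hd i j hij, hd j i (Ne.symm hij)] at h1 h2
    rw [h1, h2]
  ext i j
  by_cases hij : i = j
  · subst hij
    have : A.trace = Fintype.card ι * A i i := by
      simp [trace, diag, fun j => he j i]
    rw [ht] at this
    have hc : (Fintype.card ι : ℝ) ≠ 0 := by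
      have : Nonempty ι := ⟨i⟩
      exact_mod_cast Fintype.card_ne_zero
    rcases mul_eq_zero.mp this.symm with h | h
    · exact absurd h hc
    · simpa using h
  · simpa using hd i j hij

lemma aux_span (S : Submodule ℝ (Matrix ι ι ℝ))
    (hbr : ∀ X ∈ S, ∀ Y ∈ S, X * Y - Y * X ∈ S)
    (hE : ∀ i j : ι, i ≠ j → single i j (1 : ℝ) ∈ S) (X : Matrix ι ι ℝ) (hX : X.trace = 0) :
    X ∈ S := by
  rcases isEmpty_or_nonempty ι with hι | ⟨⟨i0⟩⟩
  · rw [Subsingleton.elim X 0]; exact S.zero_mem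
  have hD : ∀ i, single i i (1 : ℝ) - single i0 i0 1 ∈ S := by
    intro i
    by_cases hi : i = i0
    · subst hi; simp
    · have := hbr _ (hE i i0 hi) _ (hE i0 i (Ne.symm hi))
      simpa using this
  have key : X = ∑ i, ∑ j, X i j • (single i j (1 : ℝ) - if i = j then single i0 i0 (1 : ℝ) else 0) := by
    have h0 : ∑ i, X i i • single i0 i0 (1 : ℝ) = 0 := by
      rw [← Finset.sum_smul]
      have : ∑ i, X i i = 0 := hX
      rw [this, zero_smul]
    simp only [smul_sub, Finset.sum_sub_distrib, smul_ite, smul_zero, Finset.sum_ite_eq,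
      Finset.mem_univ, if_true, h0, sub_zero]
    conv_lhs => rw [matrix_eq_sum_single X]
    simp
  rw [key]
  refine S.sum_mem fun i _ => S.sum_mem fun j _ => S.smul_mem _ ?_
  by_cases hij : i = j
  · subst hij; simpa using hD i
  · simpa [hij] using hE i j hij

theorem aux_main (J : Matrix ι ι ℝ) (hJ : Jᵀ = -J) (hJJ : J * J = -1)
    (S : Submodule ℝ (Matrix ι ι ℝ))
    (hsl : ∀ X ∈ S, Matrix.trace X = 0)
    (hbr : ∀ X ∈ S, ∀ Y ∈ S, X * Y - Y * X ∈ S)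
    (hsp : ∀ X : Matrix ι ι ℝ, X.trace = 0 → Xᵀ * J + J * X = 0 → X ∈ S)
    (B : Matrix ι ι ℝ) (hB : B ∈ S) (hBsp : Bᵀ * J + J * B ≠ 0)
    (X : Matrix ι ι ℝ) (hX : X.trace = 0) : X ∈ S := by
  have hT : ∀ x y, auxR J x y + auxR J y x ∈ S := fun x y =>
    hsp _ (auxT_sp J hJ x y).1 (auxT_sp J hJ x y).2
  have hTT : ∀ x, auxR J x x ∈ S := fun x => by
    have := S.smul_mem (1/2 : ℝ) (hT x x)
    rw [← two_smul ℝ, smul_smul] at this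
    norm_num at this
    exact this
  -- antisymmetric part
  obtain ⟨A, hAS, hA, hA0⟩ : ∃ A ∈ S, J * A = Aᵀ * J ∧ A ≠ 0 := by
    have hJ2 : ∀ M : Matrix ι ι ℝ, J * (J * M) = -M := fun M => by
      rw [← Matrix.mul_assoc, hJJ]; simp
    have hs : B + J * Bᵀ * J ∈ S := by
      apply hsp
      · rw [trace_add, Matrix.mul_assoc, trace_mul_comm, Matrix.mul_assoc, hJJ]
        simp
      · simp only [transpose_add, transpose_mul, transpose_transpose, hJ, add_mul, mul_add,
          Matrix.mul_assoc, hJ2, hJJ]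
        simp [Matrix.mul_assoc, hJJ]
    refine ⟨B - J * Bᵀ * J, ?_, ?_, ?_⟩
    · have := S.sub_mem (S.smul_mem (2:ℝ) hB) hs
      convert this using 1
      rw [two_smul]; abel
    · simp only [transpose_sub, transpose_mul, transpose_transpose, hJ, sub_mul, mul_sub,
          Matrix.mul_assoc, hJ2, hJJ]
      simp [Matrix.mul_assoc, hJJ]
      abel
    · intro h
      apply hBsp
      have := congrArg (fun M => J * M) h
      simp only [mul_sub, Matrix.mul_assoc, hJ2, mul_zero, sub_neg_eq_add] at this
      rw [add_comm]; exact this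
  obtain ⟨u, hu⟩ : ∃ u : ι → ℝ, ∀ c : ℝ, A *ᵥ u ≠ c • u := by
    by_contra! hc
    exact hA0 (aux_scalar A hc (hsl A hAS))
  have hu0 : u ≠ 0 := by
    rintro rfl
    exact hu 0 (by simp)
  obtain ⟨w, hw⟩ : ∃ w, w = A *ᵥ u := ⟨_, rfl⟩
  have huw : auxw J u w = 0 := by rw [hw]; exact auxw_A J A hJ hA u
  have hW0 : auxR J u w - auxR J w u ∈ S := by
    have := hbr _ (hTT u) _ hAS
    rwa [auxR_mulA J A hA, aux_mulR, ← hw] at this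
  rw [← hw] at hu
  -- basic step
  have step : ∀ a x y, auxR J x y - auxR J y x ∈ S →
      auxR J a (auxw J a x • y - auxw J a y • x) - auxR J (auxw J a x • y - auxw J a y • x) a ∈ S := by
    intro a x y h
    have := hbr _ (hTT a) _ h
    convert this using 1
    simp only [mul_sub, sub_mul, auxR_mul]
    simp only [sub_eq_add_neg, ← neg_smul, auxR_add_left,
      auxR_add_right, auxR_smul_left, auxR_smul_right]
    rw [auxw_swap J hJ x a, auxw_swap J hJ y a]
    module
  have P1 : ∀ v, auxw J v u = 0 → auxw J v w ≠ 0 → auxR J u v - auxR J v u ∈ S := by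
    intro v h1 h2
    have := S.smul_mem (auxw J v w)⁻¹ (step v u w hW0)
    convert this using 1
    simp only [h1, zero_smul, zero_sub, ← neg_smul, auxR_smul_left, auxR_smul_right]
    rw [← smul_sub, smul_smul, mul_neg, inv_mul_cancel₀ h2]
    module
  have P : ∀ v, auxw J v u = 0 → auxR J u v - auxR J v u ∈ S := by
    intro v h1
    by_cases h2 : auxw J v w = 0
    · obtain ⟨v', h3, h4⟩ := auxw_exists J hJ hJJ u w hu
      have e1 := P1 v' h3 h4
      have e2 := P1 (v + v') (by rw [auxw_add_left, h1, h3, add_zero])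
        (by rwa [auxw_add_left, h2, zero_add])
      have := S.sub_mem e2 e1
      rw [auxR_add_left, auxR_add_right] at this
      convert this using 1
      abel
    · exact P1 v h1 h2
  have Q1 : ∀ a b, auxw J a b = 0 → auxw J a u ≠ 0 → auxR J a b - auxR J b a ∈ S := by
    intro a b hab hau
    obtain ⟨c, hc⟩ : ∃ c, c = -(auxw J b u) / auxw J a u := ⟨_, rfl⟩
    have hv : auxw J (b + c • a) u = 0 := by
      rw [auxw_add_left, auxw_smul_left, hc]
      field_simp
      ring
    have h1 := step a u _ (P _ hv)
    rw [auxw_add_right, auxw_smul_right, hab, auxw_self J hJ] at h1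
    have := S.smul_mem (auxw J a u)⁻¹ h1
    convert this using 1
    simp only [mul_zero, add_zero, zero_smul, sub_zero, auxR_smul_left, auxR_smul_right,
      auxR_add_left, auxR_add_right]
    rw [← smul_sub, smul_smul, inv_mul_cancel₀ hau]
    module
  have Q : ∀ a b, auxw J a b = 0 → auxR J a b - auxR J b a ∈ S := by
    intro a b hab
    by_cases hau : auxw J a u = 0
    · by_cases hb : ∃ c : ℝ, u = c • b
      · obtain ⟨c, hc⟩ := hb
        have hc0 : c ≠ 0 := by
          rintro rfl
          exact hu0 (by simpa using hc)
        have := S.smul_mem (-c⁻¹) (P a hau)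
        rw [hc] at this
        convert this using 1
        rw [auxR_smul_left, auxR_smul_right, ← smul_sub, smul_smul, neg_mul, inv_mul_cancel₀ hc0]
        module
      · push Not at hb
        obtain ⟨v, h3, h4⟩ := auxw_exists J hJ hJJ b u hb
        have e1 := Q1 v b h3 h4
        have e2 := Q1 (a + v) b (by rw [auxw_add_left, hab, h3, add_zero])
          (by rwa [auxw_add_left, hau, zero_add])
        have := S.sub_mem e2 e1
        rw [auxR_add_left, auxR_add_right] at this
        convert this using 1
        abel
    · exact Q1 a b hab hau
  have hR : ∀ x y, auxw J y x = 0 → auxR J x y ∈ S := by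
    intro x y h
    have := S.smul_mem (1/2 : ℝ) (S.add_mem (hT x y) (Q x y (by rw [auxw_swap J hJ, h, neg_zero])))
    convert this using 1
    module
  apply aux_span S hbr _ X hX
  intro i j hij
  have hy : (-(Pi.single j (1:ℝ) ᵥ* J)) ᵥ* J = Pi.single j (1:ℝ) := by
    rw [neg_vecMul, vecMul_vecMul, hJJ, vecMul_neg, vecMul_one, neg_neg]
  have := hR (Pi.single i 1) (-(Pi.single j (1:ℝ) ᵥ* J)) (by
    rw [auxw, hy]; simp [hij])
  rw [auxR, hy] at this
  rwa [← single_eq_single_vecMulVec_single] at this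

end aux

lemma Jmat_transpose (n : ℕ) : (Jmat n)ᵀ = -Jmat n := by
  ext i j
  simp only [transpose_apply, Jmat, Matrix.neg_apply]
  split_ifs <;> first | omega | simp

lemma Jmat_sq (n : ℕ) : Jmat n * Jmat n = -1 := by
  ext i j
  rw [mul_apply]
  by_cases hi : (i : ℕ) < n
  · rw [Finset.sum_eq_single (⟨i + n, by omega⟩ : Fin (2*n))]
    · simp only [Jmat, Matrix.neg_apply, Matrix.one_apply, Fin.ext_iff]
      split_ifs <;> first | omega | simp
    · intro b _ hb
      simp only [Jmat, ne_eq, Fin.ext_iff] at *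
      split_ifs <;> first | omega | simp
    · simp
  · rw [Finset.sum_eq_single (⟨i - n, by omega⟩ : Fin (2*n))]
    · simp only [Jmat, Matrix.neg_apply, Matrix.one_apply, Fin.ext_iff]
      split_ifs <;> first | omega | simp
    · intro b _ hb
      simp only [Jmat, ne_eq, Fin.ext_iff] at *
      split_ifs <;> first | omega | simp
    · simp

/-- Appendix (maximality): any Lie subalgebra of `sl_{2n}(ℝ)` (a subspace of traceless
matrices closed under the commutator bracket) containing `sp(2n,ℝ)` equals `sp(2n,ℝ)`
or `sl_{2n}(ℝ)`; in particular `sp(2n,ℝ)` is a maximal proper Lie subalgebra. -/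
theorem stmt15 (n : ℕ) (hn : 2 ≤ n) (S : Submodule ℝ (Mat n))
    (hsl : ∀ X ∈ S, Matrix.trace X = 0)
    (hbracket : ∀ X ∈ S, ∀ Y ∈ S, X * Y - Y * X ∈ S)
    (hsp : spSet n ⊆ S) :
    (S : Set (Mat n)) = spSet n ∨ (S : Set (Mat n)) = {X : Mat n | X.trace = 0} := by
  by_cases h : (S : Set (Mat n)) ⊆ spSet n
  · exact Or.inl (Set.Subset.antisymm h hsp)
  · right
    obtain ⟨B, hB, hB'⟩ := Set.not_subset.mp h
    refine Set.Subset.antisymm (fun X hX => hsl X hX) fun X hX => ?_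
    exact aux_main (Jmat n) (Jmat_transpose n) (Jmat_sq n) S hsl hbracket
      (fun Y h1 h2 => hsp ⟨h1, h2⟩) B hB (fun h0 => hB' ⟨hsl B hB, h0⟩) X hX
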